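/- Let R and S be disjoint nonempty compact connected subsets of ℝ². Then both set differences (convexHull ℝ R) \ (convexHull ℝ S) and (convexHull ℝ S) \ (convexHull ℝ R) are preconnected. In particular, the convex hulls of two disjoint geometric trees are weakly disjoint. -/

import Mathlib

open Set Metric Filter Topology

/-- The linear functional on the plane given by the inner product with the unit vector of
angle `θ`. -/
noncomputable def height (θ : ℝ) (p : ℝ × ℝ) : ℝ := Real.cos θ * p.1 + Real.sin θ * p.2

lemma continuous_height_uncurry : Continuous fun z : ℝ × (ℝ × ℝ) => height z.1 z.2 := by
  unfold height; fun_prop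

lemma continuous_height (θ : ℝ) : Continuous (height θ) := by
  unfold height; fun_prop

lemma isLinearMap_height (θ : ℝ) : IsLinearMap ℝ (height θ) where
  map_add p q := by simp only [height, Prod.fst_add, Prod.snd_add]; ring
  map_smul c p := by simp only [height, Prod.smul_fst, Prod.smul_snd, smul_eq_mul]; ring

lemma height_le_add_dist (θ : ℝ) (p q : ℝ × ℝ) : height θ p ≤ height θ q + 2 * dist p q := by
  have h1 : |p.1 - q.1| ≤ dist p q := le_max_left _ _
  have h2 : |p.2 - q.2| ≤ dist p q := le_max_right _ _
  have h3 : Real.cos θ * (p.1 - q.1) ≤ |p.1 - q.1| := by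
    refine (le_abs_self _).trans ?_
    rw [abs_mul]
    exact mul_le_of_le_one_left (abs_nonneg _) (Real.abs_cos_le_one θ)
  have h4 : Real.sin θ * (p.2 - q.2) ≤ |p.2 - q.2| := by
    refine (le_abs_self _).trans ?_
    rw [abs_mul]
    exact mul_le_of_le_one_left (abs_nonneg _) (Real.abs_sin_le_one θ)
  unfold height
  linarith

lemma height_add_direction (θ c : ℝ) (p : ℝ × ℝ) :
    height θ (p + (c * Real.cos θ, c * Real.sin θ)) = height θ p + c := by
  simp only [height, Prod.fst_add, Prod.snd_add]
  linear_combination c * Real.cos_sq_add_sin_sq θ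

lemma dist_add_direction_le (θ : ℝ) {c : ℝ} (hc : 0 ≤ c) (p : ℝ × ℝ) :
    dist (p + (c * Real.cos θ, c * Real.sin θ)) p ≤ c := by
  rw [dist_eq_norm, add_sub_cancel_left, Prod.norm_mk, Real.norm_eq_abs, Real.norm_eq_abs,
    abs_mul, abs_mul, abs_of_nonneg hc]
  exact max_le (mul_le_of_le_one_right hc (Real.abs_cos_le_one θ))
    (mul_le_of_le_one_right hc (Real.abs_sin_le_one θ))

/-- A continuous real function whose cosine stays positive stays in one period of the positivity
set of the cosine. -/
lemma exists_int_forall_abs_sub_lt_of_cos_pos {f : ℝ → ℝ} (hf : Continuous f)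
    (hpos : ∀ t, 0 < Real.cos (f t)) :
    ∃ k : ℤ, ∀ t, |f t - 2 * Real.pi * k| < Real.pi / 2 := by
  have hpi := Real.pi_pos
  obtain ⟨k, hk⟩ : ∃ k : ℤ, |f 0 - 2 * Real.pi * k| ≤ Real.pi := by
    refine ⟨round (f 0 / (2 * Real.pi)), ?_⟩
    have h := abs_sub_round (f 0 / (2 * Real.pi))
    have h2 : f 0 - 2 * Real.pi * (round (f 0 / (2 * Real.pi)) : ℝ) =
        2 * Real.pi * (f 0 / (2 * Real.pi) - round (f 0 / (2 * Real.pi))) := by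
      field_simp
    rw [h2, abs_mul, abs_of_pos (by positivity)]
    nlinarith
  have hcos : ∀ t, Real.cos |f t - 2 * Real.pi * k| = Real.cos (f t) := by
    intro t
    rw [Real.cos_abs, mul_comm (2 * Real.pi)]
    exact Real.cos_sub_int_mul_two_pi _ _
  refine ⟨k, fun t => ?_⟩
  by_contra! ht
  have h0 : |f 0 - 2 * Real.pi * k| ≤ Real.pi / 2 := by
    by_contra! h0
    have := Real.cos_nonpos_of_pi_div_two_le_of_le h0.le (by linarith)
    rw [hcos] at this
    exact absurd (hpos 0) (not_lt.2 this)
  have hc : Continuous fun t => |f t - 2 * Real.pi * k| := by fun_prop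
  obtain ⟨x, hx⟩ := mem_range_of_exists_le_of_exists_ge hc ⟨0, h0⟩ ⟨t, ht⟩
  have := hpos x
  rw [← hcos x, show |f x - 2 * Real.pi * k| = Real.pi / 2 from hx, Real.cos_pi_div_two] at this
  exact lt_irrefl _ this

/-- A nowhere vanishing continuous map from the plane to itself has a continuous argument. -/
lemma exists_continuous_height_eq_mul_cos {F : ℝ × ℝ → ℝ × ℝ} (hF : Continuous F)
    (h0 : ∀ z, F z ≠ 0) :
    ∃ α : ℝ × ℝ → ℝ, Continuous α ∧
      ∀ z θ, ∃ ρ : ℝ, 0 < ρ ∧ height θ (F z) = ρ * Real.cos (α z - θ) := by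
  let G : C(ℝ × ℝ, ℂ) := ⟨fun z => Complex.equivRealProdCLM.symm (F z), by fun_prop⟩
  have hG : ∀ z, G z ≠ 0 := fun z hz => h0 z (by simpa [G] using hz)
  obtain ⟨L, ⟨-, hL⟩, -⟩ := Complex.isCoveringMapOn_exp.existsUnique_continuousMap_lifts G
    (Complex.exp_log (hG 0)) hG
  refine ⟨fun z => (L z).im, by fun_prop, fun z θ => ⟨Real.exp (L z).re, Real.exp_pos _, ?_⟩⟩
  have h := congrFun hL z
  have hre : (F z).1 = Real.exp (L z).re * Real.cos (L z).im := by
    rw [← Complex.exp_re]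
    exact (congrArg Complex.re h).symm
  have him : (F z).2 = Real.exp (L z).re * Real.sin (L z).im := by
    rw [← Complex.exp_im]
    exact (congrArg Complex.im h).symm
  rw [height, hre, him, Real.cos_sub]
  ring

/-- Two curves in the plane meet if their end points are extremal, relative to the other curve,
in four alternating directions. -/
lemma exists_eq_of_alternating_heights {γ σ : ℝ → ℝ × ℝ} (hγ : Continuous γ) (hσ : Continuous σ)
    {θ₁ θ₂ φ₁ φ₂ : ℝ} (h₁ : θ₁ < φ₁) (h₂ : φ₁ < θ₂) (h₃ : θ₂ < φ₂) (h₄ : φ₂ < θ₁ + 2 * Real.pi)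
    (hγ₀ : ∀ t, height θ₁ (σ t) < height θ₁ (γ 0)) (hγ₁ : ∀ t, height θ₂ (σ t) < height θ₂ (γ 1))
    (hσ₀ : ∀ s, height φ₁ (γ s) < height φ₁ (σ 0)) (hσ₁ : ∀ s, height φ₂ (γ s) < height φ₂ (σ 1)) :
    ∃ s t, γ s = σ t := by
  by_contra! hne
  obtain ⟨α, hα, hαh⟩ := exists_continuous_height_eq_mul_cos
    (F := fun z : ℝ × ℝ => γ z.1 - σ z.2) (by fun_prop) (fun z => sub_ne_zero.2 (hne z.1 z.2))
  have key : ∀ s t θ, height θ (σ t) < height θ (γ s) → 0 < Real.cos (α (s, t) - θ) := by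
    intro s t θ h
    obtain ⟨ρ, hρ, e⟩ := hαh (s, t) θ
    rw [(isLinearMap_height θ).map_sub] at e
    have : 0 < ρ * Real.cos (α (s, t) - θ) := by rw [← e]; exact sub_pos.2 h
    exact (pos_iff_pos_of_mul_pos this).1 hρ
  have key' : ∀ s t θ, height θ (γ s) < height θ (σ t) →
      0 < Real.cos (α (s, t) - (θ + Real.pi)) := by
    intro s t θ h
    apply key
    simp only [height, Real.cos_add_pi, Real.sin_add_pi] at h ⊢
    linarith
  obtain ⟨k₁, hk₁⟩ := exists_int_forall_abs_sub_lt_of_cos_pos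
    (f := fun t => α (0, t) - θ₁) (by fun_prop) fun t => key _ _ _ (hγ₀ t)
  obtain ⟨k₂, hk₂⟩ := exists_int_forall_abs_sub_lt_of_cos_pos
    (f := fun t => α (1, t) - θ₂) (by fun_prop) fun t => key _ _ _ (hγ₁ t)
  obtain ⟨m₁, hm₁⟩ := exists_int_forall_abs_sub_lt_of_cos_pos
    (f := fun s => α (s, 0) - (φ₁ + Real.pi)) (by fun_prop) fun s => key' _ _ _ (hσ₀ s)
  obtain ⟨m₂, hm₂⟩ := exists_int_forall_abs_sub_lt_of_cos_pos
    (f := fun s => α (s, 1) - (φ₂ + Real.pi)) (by fun_prop) fun s => key' _ _ _ (hσ₁ s)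
  have hpi := Real.pi_pos
  have bound : ∀ k : ℤ, 2 * Real.pi * k < 4 * Real.pi → k ≤ 1 := by
    intro k hk
    have : (k : ℝ) < 2 := by nlinarith
    have : k < 2 := by exact_mod_cast this
    omega
  have bound' : ∀ k : ℤ, 0 < 2 * Real.pi * k → 1 ≤ k := by
    intro k hk
    have : (0 : ℝ) < k := by
      by_contra! h
      nlinarith
    have : 0 < k := by exact_mod_cast this
    omega
  have a00 := abs_lt.1 (hk₁ 0)
  have b00 := abs_lt.1 (hm₁ 0)
  have a10 := abs_lt.1 (hk₂ 0)
  have b10 := abs_lt.1 (hm₁ 1)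
  have a11 := abs_lt.1 (hk₂ 1)
  have b11 := abs_lt.1 (hm₂ 1)
  have a01 := abs_lt.1 (hk₁ 1)
  have b01 := abs_lt.1 (hm₂ 0)
  have c1 : 1 ≤ k₁ - m₁ := bound' _ (by push_cast; linarith)
  have c2 : k₂ - m₁ ≤ 0 := by
    have := bound' (1 - (k₂ - m₁)) (by push_cast; linarith)
    omega
  have c3 : 1 ≤ k₂ - m₂ := bound' _ (by push_cast; linarith)
  have c4 : k₁ - m₂ ≤ 1 := bound _ (by push_cast; linarith)
  omega

lemma IsPreconnected.thickening {E : Type*} [SeminormedAddCommGroup E] [NormedSpace ℝ E]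
    {s : Set E} (hs : IsPreconnected s) (δ : ℝ) : IsPreconnected (Metric.thickening δ s) := by
  rw [← add_ball_zero, ← add_image_prod]
  exact (hs.prod (convex_ball (0 : E) δ).isPreconnected).image _ continuous_add.continuousOn

/-- In an open connected set any two points are joined by a curve parametrised by the line. -/
lemma IsOpen.exists_continuous_curve {E : Type*} [TopologicalSpace E]
    [LocallyPathConnectedSpace E] {U : Set E} (hU : IsOpen U) (hc : IsPreconnected U) {a b : E}
    (ha : a ∈ U) (hb : b ∈ U) :
    ∃ γ : ℝ → E, Continuous γ ∧ γ 0 = a ∧ γ 1 = b ∧ ∀ t, γ t ∈ U := by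
  have hp := (hU.isConnected_iff_isPathConnected).1 ⟨⟨a, ha⟩, hc⟩
  have hj := hp.joinedIn a ha b hb
  refine ⟨hj.somePath.extend, hj.somePath.continuous_extend, by simp, by simp, fun t => ?_⟩
  obtain ⟨x, hx⟩ : hj.somePath.extend t ∈ range hj.somePath := by
    rw [← Path.extend_range]; exact mem_range_self t
  rw [← hx]
  exact hj.somePath_mem x

/-- Two plane continua meet if they are alternately extremal in four directions. -/
lemma not_disjoint_of_alternating_heights {R S : Set (ℝ × ℝ)} (hRc : IsCompact R)
    (hSc : IsCompact S) (hR : IsPreconnected R) (hS : IsPreconnected S) {θ₁ θ₂ φ₁ φ₂ : ℝ}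
    (h₁ : θ₁ < φ₁) (h₂ : φ₁ < θ₂) (h₃ : θ₂ < φ₂) (h₄ : φ₂ < θ₁ + 2 * Real.pi)
    {r₁ r₂ s₁ s₂ : ℝ × ℝ} (hr₁ : r₁ ∈ R) (hr₂ : r₂ ∈ R) (hs₁ : s₁ ∈ S) (hs₂ : s₂ ∈ S)
    (hr₁S : ∀ s ∈ S, height θ₁ s < height θ₁ r₁) (hr₂S : ∀ s ∈ S, height θ₂ s < height θ₂ r₂)
    (hs₁R : ∀ r ∈ R, height φ₁ r ≤ height φ₁ s₁) (hs₂R : ∀ r ∈ R, height φ₂ r ≤ height φ₂ s₂) :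
    ¬ Disjoint R S := by
  intro hdisj
  obtain ⟨δ, hδ, hd⟩ := hdisj.exists_thickenings hRc hSc.isClosed
  have gap : ∀ θ r, (∀ s ∈ S, height θ s < height θ r) →
      ∃ m > 0, ∀ s ∈ S, height θ s + m ≤ height θ r := by
    intro θ r h
    obtain ⟨s, hs, hmax⟩ := hSc.exists_isMaxOn ⟨s₁, hs₁⟩ (continuous_height θ).continuousOn
    refine ⟨height θ r - height θ s, sub_pos.2 (h s hs), fun s' hs' => ?_⟩
    have : height θ s' ≤ height θ s := hmax hs'
    linarith
  obtain ⟨m₁, hm₁, hm₁S⟩ := gap _ _ hr₁S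
  obtain ⟨m₂, hm₂, hm₂S⟩ := gap _ _ hr₂S
  obtain ⟨ε, hε, hεδ, hεm₁, hεm₂⟩ : ∃ ε > 0, ε ≤ δ ∧ 2 * ε ≤ m₁ ∧ 2 * ε ≤ m₂ := by
    refine ⟨min δ (min (m₁ / 2) (m₂ / 2)), by positivity, min_le_left _ _, ?_, ?_⟩
    · have := (min_le_right δ (min (m₁ / 2) (m₂ / 2))).trans (min_le_left _ _)
      linarith
    · have := (min_le_right δ (min (m₁ / 2) (m₂ / 2))).trans (min_le_right _ _)
      linarith
  have upper : ∀ {η : ℝ} {T : Set (ℝ × ℝ)} {θ c : ℝ} {p : ℝ × ℝ}, p ∈ thickening η T →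
      (∀ q ∈ T, height θ q + 2 * η ≤ c) → height θ p < c := by
    intro η T θ c p hp h
    obtain ⟨q, hq, hpq⟩ := mem_thickening_iff.1 hp
    have := height_le_add_dist θ p q
    have := h q hq
    linarith
  have mem : ∀ φ, ∀ s ∈ S,
      s + (ε / 2 * Real.cos φ, ε / 2 * Real.sin φ) ∈ thickening ε S := by
    intro φ s hs
    refine mem_thickening_iff.2 ⟨s, hs, ?_⟩
    exact (dist_add_direction_le φ (by positivity) s).trans_lt (by linarith)
  obtain ⟨γ, hγ, hγ0, hγ1, hγU⟩ := (isOpen_thickening (δ := ε / 8)).exists_continuous_curve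
    (hR.thickening _) (self_subset_thickening (by positivity) R hr₁)
    (self_subset_thickening (by positivity) R hr₂)
  obtain ⟨σ, hσ, hσ0, hσ1, hσV⟩ := (isOpen_thickening (δ := ε)).exists_continuous_curve
    (hS.thickening _) (mem φ₁ s₁ hs₁) (mem φ₂ s₂ hs₂)
  obtain ⟨s, t, hst⟩ := exists_eq_of_alternating_heights hγ hσ h₁ h₂ h₃ h₄
    (fun t => upper (hσV t) fun q hq => by rw [hγ0]; linarith [hm₁S q hq])
    (fun t => upper (hσV t) fun q hq => by rw [hγ1]; linarith [hm₂S q hq])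
    (fun s => upper (hγU s) fun q hq => by
      rw [hσ0, height_add_direction]; linarith [hs₁R q hq])
    (fun s => upper (hγU s) fun q hq => by
      rw [hσ1, height_add_direction]; linarith [hs₂R q hq])
  exact (hd.mono (thickening_mono (by linarith) R) (thickening_mono hεδ S)).ne_of_mem
    (hγU s) (hσV t) hst

/-- The part of `A` strictly above `S` in direction `θ`. -/
def cap (A S : Set (ℝ × ℝ)) (θ : ℝ) : Set (ℝ × ℝ) := {x ∈ A | ∀ s ∈ S, height θ s < height θ x}

lemma cap_subset_diff_convexHull {A S : Set (ℝ × ℝ)} (θ : ℝ) :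
    cap A S θ ⊆ A \ convexHull ℝ S := by
  rintro x ⟨hxA, hx⟩
  refine ⟨hxA, fun hxS => ?_⟩
  have : convexHull ℝ S ⊆ {y | height θ y < height θ x} :=
    convexHull_min hx (convex_halfSpace_lt (isLinearMap_height θ) _)
  exact lt_irrefl (height θ x) (this hxS)

lemma convex_cap {A S : Set (ℝ × ℝ)} (hA : Convex ℝ A) (θ : ℝ) : Convex ℝ (cap A S θ) := by
  have : cap A S θ = A ∩ ⋂ s ∈ S, {x | height θ s < height θ x} := by
    ext x; simp [cap]
  rw [this]
  exact hA.inter (convex_iInter₂ fun s _ => convex_halfSpace_gt (isLinearMap_height θ) _)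

lemma isOpen_setOf_mem_cap {A S : Set (ℝ × ℝ)} (hS : IsCompact S) (x : ℝ × ℝ) :
    IsOpen {θ | x ∈ cap A S θ} := by
  by_cases hx : x ∈ A
  · rw [isOpen_iff_mem_nhds]
    rintro θ ⟨-, hθ⟩
    have : ∀ᶠ θ' in 𝓝 θ, ∀ s ∈ S, height θ' s < height θ' x := by
      refine hS.eventually_forall_of_forall_eventually fun s hs => ?_
      have hc : Continuous fun z : ℝ × (ℝ × ℝ) => height z.1 x := by unfold height; fun_prop
      exact (continuous_height_uncurry.continuousAt.eventually_lt hc.continuousAt (hθ s hs))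
    filter_upwards [this] with θ' h using ⟨hx, h⟩
  · simp [cap, hx]

/-- Sweeping nonempty caps over an interval of directions gives a preconnected set. -/
lemma isPreconnected_iUnion_cap {A S : Set (ℝ × ℝ)} (hA : Convex ℝ A) (hS : IsCompact S)
    {I : Set ℝ} (hI : IsPreconnected I) (hne : ∀ θ ∈ I, (cap A S θ).Nonempty) :
    IsPreconnected (⋃ θ ∈ I, cap A S θ) := by
  intro U V hU hV hUV hneU hneV
  have isOpen_meet : ∀ W : Set (ℝ × ℝ), IsOpen {θ | (cap A S θ ∩ W).Nonempty} := by
    intro W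
    have : {θ | (cap A S θ ∩ W).Nonempty} = ⋃ x ∈ W, {θ | x ∈ cap A S θ} := by
      ext θ; simp [Set.Nonempty, and_comm]
    rw [this]
    exact isOpen_biUnion fun x _ => isOpen_setOf_mem_cap hS x
  have meet : ∀ W : Set (ℝ × ℝ), ((⋃ θ ∈ I, cap A S θ) ∩ W).Nonempty →
      (I ∩ {θ | (cap A S θ ∩ W).Nonempty}).Nonempty := by
    rintro W ⟨x, hx, hxW⟩
    obtain ⟨θ, hθ, hxθ⟩ := mem_iUnion₂.1 hx
    exact ⟨θ, hθ, x, hxθ, hxW⟩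
  obtain ⟨θ, hθ, hθU, hθV⟩ := hI _ _ (isOpen_meet U) (isOpen_meet V)
    (fun θ hθ => by
      obtain ⟨x, hx⟩ := hne θ hθ
      exact (hUV (mem_biUnion hθ hx)).imp (fun h => ⟨x, hx, h⟩) (fun h => ⟨x, hx, h⟩))
    (meet U hneU) (meet V hneV)
  have hsub : cap A S θ ⊆ ⋃ θ ∈ I, cap A S θ := subset_biUnion_of_mem (u := cap A S) hθ
  obtain ⟨x, hx, hxUV⟩ := (convex_cap hA θ).isPreconnected U V hU hV (hsub.trans hUV) hθU hθV
  exact ⟨x, hsub hx, hxUV⟩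

lemma IsCompact.convexJoin {E : Type*} [AddCommGroup E] [Module ℝ E] [TopologicalSpace E]
    [ContinuousAdd E] [ContinuousSMul ℝ E] {s t : Set E} (hs : IsCompact s) (ht : IsCompact t) :
    IsCompact (_root_.convexJoin ℝ s t) := by
  have h : _root_.convexJoin ℝ s t =
      (fun p : ℝ × E × E => (1 - p.1) • p.2.1 + p.1 • p.2.2) '' (Icc 0 1 ×ˢ s ×ˢ t) := by
    ext x
    simp only [mem_convexJoin, segment_eq_image, mem_image, mem_prod, Prod.exists]
    constructor
    · rintro ⟨a, ha, b, hb, θ, hθ, rfl⟩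
      exact ⟨θ, a, b, ⟨hθ, ha, hb⟩, rfl⟩
    · rintro ⟨θ, a, b, ⟨hθ, ha, hb⟩, rfl⟩
      exact ⟨a, ha, b, hb, θ, hθ, rfl⟩
  rw [h]
  exact (isCompact_Icc.prod (hs.prod ht)).image (by fun_prop)

/-- In a finite-dimensional space, the convex hull of a compact set is compact. -/
lemma IsCompact.convexHull_of_finiteDimensional {E : Type*} [AddCommGroup E] [Module ℝ E]
    [TopologicalSpace E] [ContinuousAdd E] [ContinuousSMul ℝ E] [FiniteDimensional ℝ E]
    {s : Set E} (hs : IsCompact s) : IsCompact (convexHull ℝ s) := by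
  classical
  have key : ∀ n : ℕ, ∃ K, IsCompact K ∧ K ⊆ convexHull ℝ s ∧
      ∀ t : Finset E, (t : Set E) ⊆ s → t.card ≤ n → convexHull ℝ (t : Set E) ⊆ K := by
    intro n
    induction n with
    | zero =>
      refine ⟨∅, isCompact_empty, empty_subset _, fun t _ ht => ?_⟩
      simp [Finset.card_eq_zero.1 (Nat.le_zero.1 ht)]
    | succ n ih =>
      obtain ⟨K, hK, hKs, hKt⟩ := ih
      refine ⟨s ∪ _root_.convexJoin ℝ s K, hs.union (hs.convexJoin hK),
        union_subset (subset_convexHull ℝ s)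
          (convexJoin_subset (subset_convexHull ℝ s) hKs (convex_convexHull ℝ s)), ?_⟩
      intro t
      induction t using Finset.induction_on with
      | empty => simp
      | insert x t hx _ =>
        intro hts hcard
        rw [Finset.card_insert_of_notMem hx] at hcard
        rw [Finset.coe_insert] at hts ⊢
        obtain ⟨hxs, hts⟩ := insert_subset_iff.1 hts
        rcases t.eq_empty_or_nonempty with rfl | hne
        · simpa using Or.inl hxs
        · rw [convexHull_insert (by simpa using hne)]
          exact (convexJoin_mono (singleton_subset_iff.2 hxs)
            (hKt t hts (by omega))).trans subset_union_right
  obtain ⟨K, hK, hKs, hKt⟩ := key (Module.finrank ℝ E + 1)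
  convert hK
  refine Subset.antisymm ?_ hKs
  rw [convexHull_eq_union]
  refine iUnion_subset fun t => iUnion₂_subset fun hts hind => hKt t hts ?_
  have := hind.card_le_finrank_succ
  rw [Fintype.card_coe] at this
  exact this.trans (Nat.add_le_add_right (Submodule.finrank_le _) 1)

lemma exists_mem_cap {A S : Set (ℝ × ℝ)} (hS : IsCompact S) {x : ℝ × ℝ}
    (hx : x ∈ A \ convexHull ℝ S) : ∃ θ, x ∈ cap A S θ := by
  obtain ⟨f, u, hfu, hux⟩ := geometric_hahn_banach_closed_point (convex_convexHull ℝ S)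
    hS.convexHull_of_finiteDimensional.isClosed hx.2
  let w : ℂ := ⟨f (1, 0), f (0, 1)⟩
  have hf : ∀ p, f p = ‖w‖ * height w.arg p := by
    intro p
    have hp : p = p.1 • ((1 : ℝ), (0 : ℝ)) + p.2 • ((0 : ℝ), (1 : ℝ)) := by ext <;> simp
    have h1 : f (1, 0) = ‖w‖ * Real.cos w.arg := (Complex.norm_mul_cos_arg w).symm
    have h2 : f (0, 1) = ‖w‖ * Real.sin w.arg := (Complex.norm_mul_sin_arg w).symm
    conv_lhs => rw [hp]
    rw [map_add, map_smul, map_smul, h1, h2, height, smul_eq_mul, smul_eq_mul]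
    ring
  refine ⟨w.arg, hx.1, fun s hs => ?_⟩
  have h := (hfu s (subset_convexHull ℝ S hs)).trans hux
  rw [hf, hf] at h
  exact lt_of_mul_lt_mul_left h (norm_nonneg w)

lemma exists_mem_of_cap_convexHull_nonempty {R S : Set (ℝ × ℝ)} (hS : IsCompact S)
    (hSne : S.Nonempty) {θ : ℝ} (h : (cap (convexHull ℝ R) S θ).Nonempty) :
    ∃ r ∈ R, ∀ s ∈ S, height θ s < height θ r := by
  obtain ⟨x, hxA, hx⟩ := h
  obtain ⟨s, hs, hmax⟩ := hS.exists_isMaxOn hSne (continuous_height θ).continuousOn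
  by_contra! hR
  have : convexHull ℝ R ⊆ {y | height θ y ≤ height θ s} :=
    convexHull_min
      (fun r hr => by
        obtain ⟨s', hs', hrs'⟩ := hR r hr
        exact hrs'.trans (hmax hs'))
      (convex_halfSpace_le (isLinearMap_height θ) _)
  exact absurd (hx s hs) (not_lt.2 (this hxA))

lemma exists_mem_of_cap_convexHull_eq_empty {R S : Set (ℝ × ℝ)} (hS : IsCompact S)
    (hSne : S.Nonempty) {θ : ℝ} (h : ¬ (cap (convexHull ℝ R) S θ).Nonempty) :
    ∃ s ∈ S, ∀ r ∈ R, height θ r ≤ height θ s := by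
  obtain ⟨s, hs, hmax⟩ := hS.exists_isMaxOn hSne (continuous_height θ).continuousOn
  refine ⟨s, hs, fun r hr => ?_⟩
  by_contra! hlt
  exact h ⟨r, subset_convexHull ℝ R hr, fun s' hs' => (hmax hs' : _ ≤ _).trans_lt hlt⟩

lemma cap_add_int_mul_two_pi (A S : Set (ℝ × ℝ)) (θ : ℝ) (n : ℤ) :
    cap A S (θ + n * (2 * Real.pi)) = cap A S θ := by
  simp only [cap, height, Real.cos_add_int_mul_two_pi, Real.sin_add_int_mul_two_pi]

/-- For disjoint plane continua, the difference of the convex hulls is preconnected. -/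
lemma isPreconnected_convexHull_diff_convexHull {R S : Set (ℝ × ℝ)} (hRS : Disjoint R S)
    (hSne : S.Nonempty) (hRc : IsCompact R) (hSc : IsCompact S) (hR : IsPreconnected R)
    (hS : IsPreconnected S) : IsPreconnected (convexHull ℝ R \ convexHull ℝ S) := by
  refine isPreconnected_of_forall_pair fun x hx y hy => ?_
  have sweep : ∀ a b, a ≤ b → x ∈ cap (convexHull ℝ R) S a ∪ cap (convexHull ℝ R) S b →
      y ∈ cap (convexHull ℝ R) S a ∪ cap (convexHull ℝ R) S b →
      (∀ θ ∈ Icc a b, (cap (convexHull ℝ R) S θ).Nonempty) →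
      ∃ t, t ⊆ convexHull ℝ R \ convexHull ℝ S ∧ x ∈ t ∧ y ∈ t ∧ IsPreconnected t := by
    intro a b hab hxab hyab h
    have hsub : cap (convexHull ℝ R) S a ∪ cap (convexHull ℝ R) S b ⊆
        ⋃ θ ∈ Icc a b, cap (convexHull ℝ R) S θ :=
      union_subset (subset_biUnion_of_mem (u := cap (convexHull ℝ R) S) (left_mem_Icc.2 hab))
        (subset_biUnion_of_mem (u := cap (convexHull ℝ R) S) (right_mem_Icc.2 hab))
    exact ⟨_, iUnion₂_subset fun θ _ => cap_subset_diff_convexHull θ, hsub hxab, hsub hyab,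
      isPreconnected_iUnion_cap (convex_convexHull ℝ R) hSc isPreconnected_Icc h⟩
  obtain ⟨θ₁, hθ₁⟩ := exists_mem_cap hSc hx
  obtain ⟨θ₂, hθ₂, hle, hlt⟩ : ∃ θ₂, y ∈ cap (convexHull ℝ R) S θ₂ ∧ θ₁ ≤ θ₂ ∧
      θ₂ < θ₁ + 2 * Real.pi := by
    obtain ⟨θ, hθ⟩ := exists_mem_cap hSc hy
    obtain ⟨hle, hlt⟩ := toIcoMod_mem_Ico Real.two_pi_pos θ₁ θ
    refine ⟨_, ?_, hle, hlt⟩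
    have : toIcoMod Real.two_pi_pos θ₁ θ =
        θ + (-toIcoDiv Real.two_pi_pos θ₁ θ : ℤ) * (2 * Real.pi) := by
      rw [← self_sub_toIcoDiv_zsmul, zsmul_eq_mul]
      push_cast
      ring
    rwa [this, cap_add_int_mul_two_pi]
  have hθ₁' : x ∈ cap (convexHull ℝ R) S (θ₁ + 2 * Real.pi) := by
    rw [← cap_add_int_mul_two_pi _ _ _ 1] at hθ₁
    simpa using hθ₁
  by_cases hI : ∀ θ ∈ Icc θ₁ θ₂, (cap (convexHull ℝ R) S θ).Nonempty
  · exact sweep _ _ hle (Or.inl hθ₁) (Or.inr hθ₂) hI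
  by_cases hJ : ∀ θ ∈ Icc θ₂ (θ₁ + 2 * Real.pi), (cap (convexHull ℝ R) S θ).Nonempty
  · exact sweep _ _ hlt.le (Or.inr hθ₁') (Or.inl hθ₂) hJ
  exfalso
  push Not at hI hJ
  obtain ⟨φ₁, ⟨h1, h2⟩, hφ₁⟩ := hI
  obtain ⟨φ₂, ⟨h3, h4⟩, hφ₂⟩ := hJ
  have ne : ∀ {a b : ℝ} {z}, z ∈ cap (convexHull ℝ R) S a → cap (convexHull ℝ R) S b = ∅ →
      a ≠ b := by
    rintro a b z hz hb rfl
    simp [hb] at hz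
  obtain ⟨r₁, hr₁, hr₁S⟩ := exists_mem_of_cap_convexHull_nonempty hSc hSne ⟨x, hθ₁⟩
  obtain ⟨r₂, hr₂, hr₂S⟩ := exists_mem_of_cap_convexHull_nonempty hSc hSne ⟨y, hθ₂⟩
  obtain ⟨s₁, hs₁, hs₁R⟩ := exists_mem_of_cap_convexHull_eq_empty hSc hSne
    (not_nonempty_iff_eq_empty.2 hφ₁)
  obtain ⟨s₂, hs₂, hs₂R⟩ := exists_mem_of_cap_convexHull_eq_empty hSc hSne
    (not_nonempty_iff_eq_empty.2 hφ₂)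
  exact not_disjoint_of_alternating_heights hRc hSc hR hS (h1.lt_of_ne (ne hθ₁ hφ₁))
    (h2.lt_of_ne (ne hθ₂ hφ₁).symm) (h3.lt_of_ne (ne hθ₂ hφ₂))
    (h4.lt_of_ne (ne hθ₁' hφ₂).symm) hr₁ hr₂ hs₁ hs₂ hr₁S hr₂S hs₁R hs₂R hRS

theorem convex_hulls_of_disjoint_trees_weakly_disjoint
    (R S : Set (ℝ × ℝ))
    (hRS : Disjoint R S)
    (hRne : R.Nonempty) (hSne : S.Nonempty)
    (hRc : IsCompact R) (hSc : IsCompact S)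
    (hRconn : IsConnected R) (hSconn : IsConnected S) :
    IsPreconnected (convexHull ℝ R \ convexHull ℝ S) ∧
    IsPreconnected (convexHull ℝ S \ convexHull ℝ R) :=
  ⟨isPreconnected_convexHull_diff_convexHull hRS hSne hRc hSc hRconn.isPreconnected
      hSconn.isPreconnected,
    isPreconnected_convexHull_diff_convexHull hRS.symm hRne hSc hRc hSconn.isPreconnected
      hRconn.isPreconnected⟩
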